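/- Let L be a real symmetric n×n matrix with eigendecomposition L = U Λ Uᵀ, where U is orthogonal and Λ = diag(λ₁,…,λₙ) with λ₁ ≤ ⋯ ≤ λₙ. Let g be a real univariate polynomial with g(λⱼ) ≠ 0 for all j, set Φ = g(L) and denote by φᵢᵀ the i-th row of Φ. Fix k ≤ n and let U_k be the n×k matrix of the first k columns of U. Let p = (p₁,…,pₙ) be a probability vector with pᵢ > 0 for all i, let c₁ = min_{1≤j≤k} g(λⱼ)², c₂ = max_{1≤j≤k} g(λⱼ)², and ζ = max_{1≤i≤n} ‖U_kᵀ φᵢ‖₂² / pᵢ. Let ω₁,…,ω_m be drawn i.i.d. from {1,…,n} according to p (i.e., distributed according to the m-fold product of the PMF p), let Ψ be the m×n matrix with rows φ_{ω₁}ᵀ,…,φ_{ω_m}ᵀ and P_Ω = diag(p_{ω₁},…,p_{ω_m}). Then for any ε, δ ∈ (0,1), if m ≥ (3ζ/(c₁δ²))·log(2k/ε), with probability at least 1−ε the following holds simultaneously for all x ∈ span(U_k): (1−δ)·c₁·‖x‖₂² ≤ (1/m)·‖P_Ω^{−1/2} Ψ x‖₂² ≤ (1+δ)·c₂·‖x‖₂².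 -/

import Mathlib

open Matrix MeasureTheory

section LieTrotter
open NormedSpace Filter Topology

theorem aux_norm_exp_le {𝔸 : Type*} [NormedRing 𝔸] [NormedAlgebra ℝ 𝔸] [CompleteSpace 𝔸]
    [NormOneClass 𝔸] (x : 𝔸) : ‖exp x‖ ≤ Real.exp ‖x‖ := by
  have h1 := NormedSpace.exp_series_hasSum_exp' (𝕂 := ℝ) x
  have h2 := NormedSpace.exp_series_hasSum_exp' (𝕂 := ℝ) ‖x‖
  rw [← Real.exp_eq_exp_ℝ] at h2
  have hb : ∀ n : ℕ, ‖((n.factorial : ℝ))⁻¹ • x ^ n‖ ≤ ((n.factorial : ℝ))⁻¹ • ‖x‖ ^ n := by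
    intro n
    rw [norm_smul, smul_eq_mul]
    have : ‖((n.factorial : ℝ))⁻¹‖ = ((n.factorial : ℝ))⁻¹ := by
      rw [Real.norm_of_nonneg]; positivity
    rw [this]
    gcongr
    exact norm_pow_le x n
  have h := tsum_of_norm_bounded h2 hb
  rwa [h1.tsum_eq] at h

theorem aux_pow_sub {𝔸 : Type*} [NormedRing 𝔸] [NormOneClass 𝔸] (X Y : 𝔸) (K : ℝ) (hK : 1 ≤ K)
    (hX : ‖X‖ ≤ K) (hY : ‖Y‖ ≤ K) (j : ℕ) : ‖X ^ j - Y ^ j‖ ≤ j * K ^ j * ‖X - Y‖ := by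
  induction j with
  | zero => simp
  | succ j ih =>
    have e : X ^ (j+1) - Y ^ (j+1) = X ^ j * (X - Y) + (X ^ j - Y ^ j) * Y := by
      rw [pow_succ, pow_succ]; noncomm_ring
    have h1 : ‖X ^ j‖ ≤ K ^ j := (norm_pow_le X j).trans (by gcongr)
    have hK0 : 0 ≤ K := by linarith
    calc ‖X ^ (j+1) - Y ^ (j+1)‖ ≤ ‖X ^ j‖ * ‖X - Y‖ + ‖X ^ j - Y ^ j‖ * ‖Y‖ := by
          rw [e]; exact (norm_add_le _ _).trans (add_le_add (norm_mul_le _ _) (norm_mul_le _ _))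
      _ ≤ K ^ j * ‖X - Y‖ + (j * K ^ j * ‖X - Y‖) * K := by gcongr
      _ ≤ K ^ (j+1) * ‖X - Y‖ + (j * K ^ j * ‖X - Y‖) * K := by
          gcongr
          omega
      _ = _ := by push_cast; ring

theorem lie_trotter_aux {𝔸 : Type*} [NormedRing 𝔸] [NormedAlgebra ℝ 𝔸] [CompleteSpace 𝔸]
    [NormOneClass 𝔸] (A B : 𝔸) :
    Tendsto (fun n : ℕ => (exp ((n : ℝ)⁻¹ • A) * exp ((n : ℝ)⁻¹ • B)) ^ n) atTop
      (𝓝 (exp (A + B))) := by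
  have hd : HasDerivAt (fun t : ℝ => exp (t • A) * exp (t • B) - exp (t • (A + B))) 0 0 := by
    have hA := hasDerivAt_exp_smul_const (𝕂 := ℝ) A 0
    have hB := hasDerivAt_exp_smul_const (𝕂 := ℝ) B 0
    have hAB := hasDerivAt_exp_smul_const (𝕂 := ℝ) (A + B) 0
    have hh := (hA.mul hB).sub hAB
    simp only [zero_smul, exp_zero, one_mul, mul_one, sub_self] at hh
    exact hh
  have hs := hd.tendsto_slope_zero
  simp only [zero_add, zero_smul, exp_zero, one_mul, sub_self, sub_zero] at hs
  have hinv : Tendsto (fun n : ℕ => (n : ℝ)⁻¹) atTop (𝓝[≠] 0) := by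
    rw [tendsto_nhdsWithin_iff]
    refine ⟨tendsto_inv_atTop_nhds_zero_nat, ?_⟩
    filter_upwards [eventually_gt_atTop 0] with n hn
    simp; omega
  have hs2 := (hs.comp hinv).norm
  simp only [Function.comp_def, inv_inv, norm_zero] at hs2
  have hs3 := hs2.const_mul (Real.exp (‖A‖ + ‖B‖))
  rw [mul_zero] at hs3
  rw [tendsto_iff_norm_sub_tendsto_zero]
  refine squeeze_zero' (Eventually.of_forall fun n => norm_nonneg _) ?_ hs3
  filter_upwards [eventually_gt_atTop 0] with n hn
  have hn' : (0 : ℝ) < n := by exact_mod_cast hn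
  set t := (n : ℝ)⁻¹ with ht
  have htp : 0 < t := by positivity
  have e : exp (A + B) = exp (t • (A + B)) ^ n := by
    let _ : NormedAlgebra ℚ 𝔸 := NormedAlgebra.restrictScalars ℚ ℝ 𝔸
    rw [← NormedSpace.exp_nsmul, ← Nat.cast_smul_eq_nsmul ℝ, smul_smul, ht, mul_inv_cancel₀ hn'.ne', one_smul]
  have hnt (Z : 𝔸) : ‖t • Z‖ = t * ‖Z‖ := by rw [norm_smul, Real.norm_of_nonneg htp.le]
  rw [e]
  refine (aux_pow_sub _ _ (Real.exp (t * (‖A‖ + ‖B‖))) ?_ ?_ ?_ n).trans ?_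
  · apply Real.one_le_exp; positivity
  · refine (norm_mul_le _ _).trans ?_
    rw [mul_add, Real.exp_add, ← hnt, ← hnt]
    gcongr <;> exact aux_norm_exp_le _
  · refine (aux_norm_exp_le _).trans ?_
    rw [hnt]
    gcongr
    exact norm_add_le _ _
  · rw [← Real.exp_nat_mul, ← mul_assoc, ht, mul_inv_cancel₀ hn'.ne', one_mul, norm_smul,
      Real.norm_of_nonneg hn'.le]
    apply le_of_eq; ring

end LieTrotter

section GT
variable {k : ℕ}

theorem tr_mul_transpose_nonneg (X : Matrix (Fin k) (Fin k) ℝ) : 0 ≤ (X * Xᵀ).trace := by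
  simp only [trace, diag, mul_apply, transpose_apply]
  exact Finset.sum_nonneg fun i _ => Finset.sum_nonneg fun j _ => mul_self_nonneg _

theorem tr_cs (X Y : Matrix (Fin k) (Fin k) ℝ) :
    2 * (X * Y).trace ≤ (X * Xᵀ).trace + (Y * Yᵀ).trace := by
  have h := tr_mul_transpose_nonneg (X - Yᵀ)
  have e1 : (Yᵀ * Xᵀ).trace = (X * Y).trace := by rw [← transpose_mul, trace_transpose]
  have e2 : (Yᵀ * Y).trace = (Y * Yᵀ).trace := trace_mul_comm _ _
  simp only [transpose_sub, transpose_transpose, sub_mul, mul_sub, trace_sub] at h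
  linarith

theorem tr_mul_pow_comm (X Y : Matrix (Fin k) (Fin k) ℝ) (j : ℕ) :
    ((X * Y) ^ j).trace = ((Y * X) ^ j).trace := by
  cases j with
  | zero => simp
  | succ j =>
    have : (X * Y) ^ (j+1) = X * ((Y * X) ^ j * Y) := by
      rw [← mul_assoc]
      induction j with
      | zero => simp
      | succ j ih => rw [pow_succ, ih, pow_succ (Y * X)]; simp only [mul_assoc]
    rw [this, trace_mul_comm, mul_assoc, ← pow_succ]

theorem gt_pow (j : ℕ) : 
    (∀ X : Matrix (Fin k) (Fin k) ℝ, (X ^ (2 ^ (j+1))).trace ≤ ((X * Xᵀ) ^ (2 ^ j)).trace) ∧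
    (∀ A B : Matrix (Fin k) (Fin k) ℝ, Aᵀ = A → Bᵀ = B →
      ((A * B) ^ (2 ^ j)).trace ≤ (A ^ (2 ^ j) * B ^ (2 ^ j)).trace) := by
  induction j with
  | zero =>
    refine ⟨fun X => ?_, fun A B _ _ => by simp⟩
    have := tr_cs X X
    simp only [zero_add, pow_one, pow_zero, pow_two]; linarith
  | succ j ih =>
    obtain ⟨ih1, ih2⟩ := ih
    have hS : ∀ X : Matrix (Fin k) (Fin k) ℝ, 
        (X ^ (2 ^ (j+1+1))).trace ≤ ((X * Xᵀ) ^ (2 ^ (j+1))).trace := by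
      intro X
      have h1 := ih1 (X ^ 2)
      rw [← pow_mul, ← pow_succ'] at h1
      have h2 : (((X ^ 2) * (X ^ 2)ᵀ) ^ 2 ^ j).trace = ((Xᵀ * X * (X * Xᵀ)) ^ 2 ^ j).trace := by
        have : X ^ 2 * (X ^ 2)ᵀ = X * (X * Xᵀ * Xᵀ) := by
          simp only [pow_two, transpose_mul, mul_assoc]
        rw [this, tr_mul_pow_comm, tr_mul_pow_comm (Xᵀ * X)]
        simp only [mul_assoc]
      have h3 := ih2 (Xᵀ * X) (X * Xᵀ) (by simp) (by simp)
      have h4 := tr_cs ((Xᵀ * X) ^ 2 ^ j) ((X * Xᵀ) ^ 2 ^ j)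
      simp only [transpose_pow, transpose_mul, transpose_transpose, ← pow_two, ← pow_mul,
        ← pow_succ] at h4
      rw [tr_mul_pow_comm Xᵀ X] at h4
      linarith
    refine ⟨hS, fun A B hA hB => ?_⟩
    have h2 := ih1 (A * B)
    have h3 : ((A * B * (A * B)ᵀ) ^ 2 ^ j).trace = (((A ^ 2) * (B ^ 2)) ^ 2 ^ j).trace := by
      have : A * B * (A * B)ᵀ = A * (B * B * A) := by
        simp only [transpose_mul, hA, hB, mul_assoc]
      rw [this, tr_mul_pow_comm, tr_mul_pow_comm (A ^ 2)]
      simp only [pow_two, mul_assoc]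
    have h4 := ih2 (A ^ 2) (B ^ 2) (by rw [transpose_pow, hA]) (by rw [transpose_pow, hB])
    rw [← pow_mul, ← pow_mul, ← pow_succ'] at h4
    linarith

open NormedSpace Filter Topology in
attribute [local instance] Matrix.linftyOpNormedRing Matrix.linftyOpNormedAlgebra 
  Matrix.linfty_opNormOneClass in
theorem golden_thompson [Nonempty (Fin k)] (A B : Matrix (Fin k) (Fin k) ℝ) (hA : Aᵀ = A) (hB : Bᵀ = B) :
    (exp (A + B)).trace ≤ (exp A * exp B).trace := by
  have h := lie_trotter_aux A B
  have h2 : Tendsto (fun j : ℕ => 2 ^ j) atTop atTop :=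
    tendsto_pow_atTop_atTop_of_one_lt (by norm_num : 1 < 2)
  have h3 := h.comp h2
  have hc : Continuous (fun M : Matrix (Fin k) (Fin k) ℝ => M.trace) := by fun_prop
  have h4 := (hc.tendsto _).comp h3
  refine le_of_tendsto h4 (Eventually.of_forall fun j => ?_)
  simp only [Function.comp]
  set t := (((2 ^ j : ℕ) : ℝ))⁻¹ with ht
  have hT (Z : Matrix (Fin k) (Fin k) ℝ) (hZ : Zᵀ = Z) : (exp (t • Z))ᵀ = exp (t • Z) := by
    rw [← Matrix.exp_transpose, transpose_smul, hZ]
  refine ((gt_pow j).2 _ _ (hT A hA) (hT B hB)).trans (le_of_eq ?_)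
  have e (Z : Matrix (Fin k) (Fin k) ℝ) : exp (t • Z) ^ (2 ^ j) = exp Z := by
    rw [← Matrix.exp_nsmul, ← Nat.cast_smul_eq_nsmul ℝ, smul_smul, ht, mul_inv_cancel₀ (by positivity), one_smul]
  rw [e, e]

end GT

section Chernoff
variable {k : ℕ}

theorem exp_psd_aux (M : Matrix (Fin k) (Fin k) ℝ) (hM : Mᵀ = M) :
    (NormedSpace.exp M).PosSemidef := by
  have e : NormedSpace.exp M = (NormedSpace.exp ((1/2 : ℝ) • M))ᴴ * NormedSpace.exp ((1/2 : ℝ) • M) := by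
    rw [← Matrix.exp_conjTranspose, conjTranspose_smul, conjTranspose_eq_transpose_of_trivial, hM]
    rw [← Matrix.exp_add_of_commute _ _ (by simp), ← add_smul]
    norm_num
  rw [e]
  exact posSemidef_conjTranspose_mul_self _

theorem trace_mul_le_aux (M E : Matrix (Fin k) (Fin k) ℝ) (hM : Mᵀ = M) (ρ : ℝ)
    (hE : (ρ • (1 : Matrix (Fin k) (Fin k) ℝ) - E).PosSemidef) :
    (NormedSpace.exp M * E).trace ≤ ρ * (NormedSpace.exp M).trace := by
  set B := NormedSpace.exp ((1/2 : ℝ) • M) with hB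
  have hBt : Bᴴ = B := by
    rw [hB, ← Matrix.exp_conjTranspose, conjTranspose_smul, conjTranspose_eq_transpose_of_trivial, hM]
    simp
  have e : NormedSpace.exp M = B * B := by
    rw [hB, ← Matrix.exp_add_of_commute _ _ (by simp), ← add_smul]
    norm_num
  have h := (hE.mul_mul_conjTranspose_same B).trace_nonneg
  rw [hBt, trace_mul_comm, ← mul_assoc, ← e] at h
  simp only [mul_sub, trace_sub, mul_smul_comm, mul_one, trace_smul, smul_eq_mul] at h
  linarith

theorem master_aux [Nonempty (Fin k)] {n : ℕ} (A : Fin n → Matrix (Fin k) (Fin k) ℝ) (hA : ∀ i, (A i)ᵀ = A i)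
    (p : Fin n → ℝ) (hp : ∀ i, 0 < p i) (ρ : ℝ) (hρ : 0 ≤ ρ)
    (hE : (ρ • (1 : Matrix (Fin k) (Fin k) ℝ) - ∑ i, p i • NormedSpace.exp (A i)).PosSemidef) (m : ℕ) :
    ∑ ω : Fin m → Fin n, (∏ i, p (ω i)) * (NormedSpace.exp (∑ i, A (ω i))).trace ≤ ρ ^ m * k := by
  induction m with
  | zero => simp
  | succ m ih =>
    rw [← (Fin.consEquiv (fun _ : Fin (m+1) => Fin n)).sum_comp, Fintype.sum_prod_type_right]
    simp only [Fin.consEquiv_apply, Fin.prod_univ_succ, Fin.sum_univ_succ, Fin.cons_zero, Fin.cons_succ]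
    calc _ ≤ ∑ ω : Fin m → Fin n, (∏ i, p (ω i)) * (ρ * (NormedSpace.exp (∑ i, A (ω i))).trace) := by
          refine Finset.sum_le_sum fun ω _ => ?_
          have hS : (∑ i, A (ω i))ᵀ = ∑ i, A (ω i) := by
            rw [transpose_sum]; simp [hA]
          have h1 := trace_mul_le_aux (∑ i, A (ω i)) _ hS ρ hE
          have hpp : 0 ≤ ∏ i, p (ω i) := Finset.prod_nonneg fun i _ => (hp _).le
          refine le_trans ?_ (mul_le_mul_of_nonneg_left h1 hpp)
          rw [Finset.mul_sum, trace_sum, Finset.mul_sum]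
          refine Finset.sum_le_sum fun i _ => ?_
          rw [mul_smul_comm, trace_smul, smul_eq_mul, mul_comm (p i), mul_assoc]
          refine mul_le_mul_of_nonneg_left (mul_le_mul_of_nonneg_left ?_ (hp i).le) hpp
          rw [add_comm]
          exact golden_thompson _ _ hS (hA i)
      _ = ρ * ∑ ω : Fin m → Fin n, (∏ i, p (ω i)) * (NormedSpace.exp (∑ i, A (ω i))).trace := by
          rw [Finset.mul_sum]; refine Finset.sum_congr rfl fun ω _ => by ring
      _ ≤ ρ * (ρ ^ m * k) := mul_le_mul_of_nonneg_left ih hρ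
      _ = _ := by ring

theorem trace_exp_lower (S : Matrix (Fin k) (Fin k) ℝ) (hS : Sᵀ = S) (t : ℝ) (y : Fin k → ℝ)
    (hy : t * (y ⬝ᵥ y) < y ⬝ᵥ (S *ᵥ y)) : Real.exp t ≤ (NormedSpace.exp S).trace := by
  have hH : S.IsHermitian := by
    rw [IsHermitian, conjTranspose_eq_transpose_of_trivial, hS]
  set V : Matrix (Fin k) (Fin k) ℝ := (hH.eigenvectorUnitary : Matrix (Fin k) (Fin k) ℝ) with hV
  set d := hH.eigenvalues with hd
  have h1 : Vᵀ * V = 1 := by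
    have := Unitary.coe_star_mul_self hH.eigenvectorUnitary
    rwa [star_eq_conjTranspose, conjTranspose_eq_transpose_of_trivial] at this
  have h2 : V * Vᵀ = 1 := by
    exact mul_eq_one_comm.1 h1
  have hsp : S = V * diagonal d * Vᵀ := by
    have := hH.spectral_theorem
    rw [Unitary.conjStarAlgAut_apply, star_eq_conjTranspose, conjTranspose_eq_transpose_of_trivial] at this
    exact this
  have hinv : V⁻¹ = Vᵀ := Matrix.inv_eq_right_inv h2
  have htr : (NormedSpace.exp S).trace = ∑ i, Real.exp (d i) := by
    rw [hsp, ← hinv, Matrix.exp_conj _ _ (IsUnit.of_mul_eq_one _ h2), hinv, trace_mul_comm,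
      ← mul_assoc, h1, one_mul, Matrix.exp_diagonal, trace_diagonal]
    refine Finset.sum_congr rfl fun i _ => ?_
    rw [Real.exp_eq_exp_ℝ, Pi.coe_exp]
  set z := Vᵀ *ᵥ y with hz
  have hzz : z ⬝ᵥ z = y ⬝ᵥ y := by
    rw [hz, dotProduct_mulVec, vecMul_transpose, mulVec_mulVec, h2, one_mulVec]
  have hq : y ⬝ᵥ (S *ᵥ y) = ∑ i, d i * z i ^ 2 := by
    rw [hsp, ← mulVec_mulVec, ← mulVec_mulVec, dotProduct_mulVec, ← mulVec_transpose, ← hz]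
    simp only [dotProduct, mulVec_diagonal]
    refine Finset.sum_congr rfl fun i _ => by ring
  have : ∃ i, t < d i := by
    by_contra! hcon
    rw [hq, ← hzz] at hy
    have : ∑ i, d i * z i ^ 2 ≤ t * (z ⬝ᵥ z) := by
      simp only [dotProduct, Finset.mul_sum]
      refine Finset.sum_le_sum fun i _ => ?_
      rw [← pow_two]
      exact mul_le_mul_of_nonneg_right (hcon i) (sq_nonneg _)
    linarith
  obtain ⟨i, hi⟩ := this
  rw [htr]
  exact (Real.exp_le_exp.2 hi.le).trans (Finset.single_le_sum (f := fun i => Real.exp (d i)) (fun j _ => (Real.exp_pos _).le) (Finset.mem_univ i))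

open NormedSpace in
attribute [local instance] Matrix.linftyOpNormedRing Matrix.linftyOpNormedAlgebra in
theorem exp_idem_aux (P : Matrix (Fin k) (Fin k) ℝ) (hP : P * P = P) (s : ℝ) :
    NormedSpace.exp (s • P) = 1 + (Real.exp s - 1) • P := by
  have h1 := NormedSpace.exp_series_hasSum_exp' (𝕂 := ℝ) (s • P)
  have h2 := NormedSpace.exp_series_hasSum_exp' (𝕂 := ℝ) s
  rw [← Real.exp_eq_exp_ℝ] at h2
  have h3 := (h2.smul_const P).add (hasSum_ite_eq (0 : ℕ) (1 - P))
  have hpow : ∀ j : ℕ, P ^ (j + 1) = P := by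
    intro j
    induction j with
    | zero => simp
    | succ j ih => rw [pow_succ, ih, hP]
  have he : (fun b : ℕ => (((b.factorial : ℝ))⁻¹ • s ^ b) • P + if b = 0 then 1 - P else 0) =
      fun b : ℕ => ((b.factorial : ℝ))⁻¹ • (s • P) ^ b := by
    funext b
    cases b with
    | zero => simp
    | succ b => simp only [smul_pow, hpow, smul_smul, smul_eq_mul, Nat.succ_ne_zero, if_false, add_zero]
  rw [he] at h3
  refine (h1.unique h3).trans ?_
  · rw [sub_smul, one_smul]; abel

theorem rank_one_aux (v : Fin k → ℝ) (R θ : ℝ) (hR : 0 < R) (hv : v ⬝ᵥ v ≤ R) :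
    ((1 + ((Real.exp (θ * R) - 1) / R) • vecMulVec v v) - NormedSpace.exp (θ • vecMulVec v v)).PosSemidef := by
  have hpsd : (vecMulVec v v).PosSemidef := by
    have := posSemidef_vecMulVec_self_star v
    simpa using this
  have h0 : 0 ≤ v ⬝ᵥ v := Finset.sum_nonneg fun i _ => mul_self_nonneg _
  rcases h0.eq_or_lt with h | h
  · have : v = 0 := by simpa using h.symm
    subst this
    have : (vecMulVec (0 : Fin k → ℝ) (0 : Fin k → ℝ)) = 0 := by ext; simp [vecMulVec]
    rw [this]
    simp [PosSemidef.zero]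
  · set r := v ⬝ᵥ v with hr
    have hid : (r⁻¹ • vecMulVec v v) * (r⁻¹ • vecMulVec v v) = r⁻¹ • vecMulVec v v := by
      rw [smul_mul_smul_comm, vecMulVec_mul_vecMulVec, ← hr]
      ext i j
      simp [vecMulVec]
      field_simp
    have e : θ • vecMulVec v v = (θ * r) • (r⁻¹ • vecMulVec v v) := by
      rw [smul_smul]; congr 1; field_simp
    rw [e, exp_idem_aux _ hid, add_sub_add_left_eq_sub, smul_smul, ← sub_smul]
    apply hpsd.smul
    have hc := convexOn_exp.2 (Set.mem_univ 0) (Set.mem_univ (θ * R))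
      (by rw [sub_nonneg, div_le_one hR]; exact hv : 0 ≤ 1 - r / R) (by positivity : 0 ≤ r / R) (by ring)
    simp only [smul_eq_mul, mul_zero, zero_add, Real.exp_zero, mul_one] at hc
    have e2 : r / R * (θ * R) = θ * r := by field_simp
    rw [e2] at hc
    have : (Real.exp (θ * r) - 1) * r⁻¹ ≤ (Real.exp (θ * R) - 1) / R := by
      rw [← div_eq_mul_inv, div_le_div_iff₀ h hR]
      have := mul_le_mul_of_nonneg_right hc hR.le
      have e3 : (1 - r / R + r / R * Real.exp (θ * R)) * R = R - r + r * Real.exp (θ * R) := by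
        field_simp
      rw [e3] at this
      nlinarith
    linarith

theorem tail_aux [Nonempty (Fin k)] {n m : ℕ} (p : Fin n → ℝ) (hp : ∀ i, 0 < p i) (hp1 : ∑ i, p i = 1)
    (v : Fin n → Fin k → ℝ) (R c θ t : ℝ) (hR : 0 < R) (hv : ∀ i, v i ⬝ᵥ v i ≤ R)
    (hc : (((Real.exp (θ * R) - 1) / R) • (c • (1 : Matrix (Fin k) (Fin k) ℝ) - ∑ i, p i • vecMulVec (v i) (v i))).PosSemidef)
    (s : Finset (Fin m → Fin n))
    (hs : ∀ ω ∈ s, ∃ y : Fin k → ℝ, t * (y ⬝ᵥ y) < θ * ∑ i, (v (ω i) ⬝ᵥ y) ^ 2) :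
    ∑ ω ∈ s, ∏ i, p (ω i) ≤ k * Real.exp (m * ((Real.exp (θ * R) - 1) / R * c) - t) := by
  set a := (Real.exp (θ * R) - 1) / R with ha
  set ρ := Real.exp (a * c) with hρ
  have hsymm : ∀ i, (θ • vecMulVec (v i) (v i))ᵀ = θ • vecMulVec (v i) (v i) := by
    intro i; rw [transpose_smul, transpose_vecMulVec]
  have hE : (ρ • (1 : Matrix (Fin k) (Fin k) ℝ) -
      ∑ i, p i • NormedSpace.exp (θ • vecMulVec (v i) (v i))).PosSemidef := by
    have h1 : (∑ i, p i • ((1 + a • vecMulVec (v i) (v i)) - NormedSpace.exp (θ • vecMulVec (v i) (v i)))).PosSemidef :=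
      posSemidef_sum _ fun i _ => (rank_one_aux (v i) R θ hR (hv i)).smul (hp i).le
    have h2 : ((ρ - (1 + a * c)) • (1 : Matrix (Fin k) (Fin k) ℝ)).PosSemidef := by
      apply PosSemidef.one.smul
      have := Real.add_one_le_exp (a * c)
      linarith
    have h3 := (h1.add hc).add h2
    convert h3 using 1
    simp only [smul_sub, smul_add, Finset.sum_sub_distrib, Finset.sum_add_distrib, ← Finset.sum_smul, hp1,
      sub_smul, add_smul, one_smul, Finset.smul_sum, smul_smul, mul_comm]
    abel
  have hM := master_aux (fun i => θ • vecMulVec (v i) (v i)) hsymm p hp ρ (Real.exp_pos _).le hE m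
  have hpp : ∀ ω : Fin m → Fin n, 0 ≤ ∏ i, p (ω i) := fun ω => Finset.prod_nonneg fun i _ => (hp _).le
  have hSs : ∀ ω : Fin m → Fin n, (∑ i, θ • vecMulVec (v (ω i)) (v (ω i)))ᵀ = ∑ i, θ • vecMulVec (v (ω i)) (v (ω i)) := by
    intro ω; rw [transpose_sum]; exact Finset.sum_congr rfl fun i _ => hsymm _
  have h4 : (∑ ω ∈ s, ∏ i, p (ω i)) * Real.exp t ≤ ρ ^ m * k := by
    refine le_trans ?_ hM
    rw [Finset.sum_mul]
    refine le_trans (Finset.sum_le_sum fun ω hω => ?_) (Finset.sum_le_sum_of_subset_of_nonneg (Finset.subset_univ s) fun ω _ _ => ?_)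
    · refine mul_le_mul_of_nonneg_left ?_ (hpp ω)
      obtain ⟨y, hy⟩ := hs ω hω
      refine trace_exp_lower _ (hSs ω) t y ?_
      convert hy using 1
      rw [sum_mulVec, dotProduct_sum, Finset.mul_sum]
      refine Finset.sum_congr rfl fun i _ => ?_
      rw [smul_mulVec, dotProduct_smul, vecMulVec_mulVec]
      simp [dotProduct_comm y]
      ring_nf
      simp
    · exact mul_nonneg (hpp ω) (exp_psd_aux _ (hSs ω)).trace_nonneg
  rw [Real.exp_sub, mul_div_assoc', le_div_iff₀ (Real.exp_pos _), Real.exp_nat_mul]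
  linarith

end Chernoff

theorem scalar_up (δ : ℝ) (h : 0 < δ) (h1 : δ < 1) : δ ^ 2 / 3 ≤ (1 + δ) * Real.log (1 + δ) - δ := by
  have := Real.le_log_one_add_of_nonneg h.le
  have h2 := mul_le_mul_of_nonneg_left this (by linarith : 0 ≤ 1 + δ)
  have h3 : (1 + δ) * (2 * δ / (δ + 2)) - δ = δ ^ 2 / (δ + 2) := by field_simp; ring
  have h4 : δ ^ 2 / 3 ≤ δ ^ 2 / (δ + 2) := by
    apply div_le_div_of_nonneg_left <;> nlinarith
  linarith

theorem scalar_low (δ : ℝ) (h : 0 < δ) (h1 : δ < 1) : δ ^ 2 / 3 ≤ (1 - δ) * Real.log (1 - δ) + δ := by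
  have hp : 0 < 1 - δ := by linarith
  have h2 := Real.self_le_sinh_iff.2 (Real.log_nonneg ((one_le_inv₀ hp).2 (by linarith)))
  rw [Real.sinh_log (by positivity), Real.log_inv, inv_inv] at h2
  have h3 := mul_le_mul_of_nonneg_left h2 hp.le
  have h4 : (1 - δ) * (((1 - δ)⁻¹ - (1 - δ)) / 2) = δ - δ ^ 2 / 2 := by field_simp; ring
  nlinarith

theorem measure_pi_real_finset {n m : ℕ} (p : Fin n → ℝ) (hp : ∀ i, 0 < p i)
    (ν : Measure (Fin n)) [IsProbabilityMeasure ν]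
    (hν : ∀ i : Fin n, ν {i} = ENNReal.ofReal (p i)) (s : Finset (Fin m → Fin n)) :
    (Measure.pi fun _ : Fin m => ν) (s : Set (Fin m → Fin n)) = ENNReal.ofReal (∑ ω ∈ s, ∏ i, p (ω i)) := by
  rw [← sum_measure_singleton, ENNReal.ofReal_sum_of_nonneg (fun ω _ => Finset.prod_nonneg fun i _ => (hp _).le)]
  refine Finset.sum_congr rfl fun ω _ => ?_
  rw [Measure.pi_singleton, ENNReal.ofReal_prod_of_nonneg (fun i _ => (hp _).le)]
  simp [hν]

theorem phi_mul_U {n : ℕ} (L U : Matrix (Fin n) (Fin n) ℝ) (lam : Fin n → ℝ) 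
    (hU : Uᵀ * U = 1) (hL : L = U * Matrix.diagonal lam * Uᵀ) (g : Polynomial ℝ) :
    Polynomial.aeval L g * U = U * diagonal (fun j => g.eval (lam j)) := by
  have hLU : L * U = U * diagonal lam := by rw [hL, mul_assoc, hU, mul_one]
  have hpow : ∀ j : ℕ, L ^ j * U = U * diagonal (fun i => lam i ^ j) := by
    intro j
    induction j with
    | zero => simp
    | succ j ih => 
      rw [pow_succ, mul_assoc, hLU, ← mul_assoc, ih, mul_assoc, diagonal_mul_diagonal]
      simp only [pow_succ]
  induction g using Polynomial.induction_on' with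
  | add f g hf hg => 
    rw [map_add, add_mul, hf, hg, ← mul_add, diagonal_add]
    simp only [Polynomial.eval_add]
  | monomial j a => 
    rw [Polynomial.aeval_monomial, mul_assoc, hpow, Algebra.algebraMap_eq_smul_one, smul_mul_assoc, one_mul,
      ← mul_smul_comm, ← diagonal_smul]
    congr 2
    funext i
    simp [Polynomial.eval_monomial]

theorem exponent_bound (k m : ℕ) (hk : 0 < k) (ζ c c₁ δ ε : ℝ) (hζ : 0 < ζ) (hc₁ : 0 < c₁) (hc : c₁ ≤ c)
    (hδ : 0 < δ) (hε : 0 < ε) (hm : 3 * ζ / (c₁ * δ ^ 2) * Real.log (2 * k / ε) ≤ (m : ℝ)) (E q : ℝ)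
    (hq : δ ^ 2 / 3 ≤ q) (hE : E = - (m * c / ζ * q)) :
    k * Real.exp E ≤ ε / 2 := by
  have hk' : (0 : ℝ) < k := by exact_mod_cast hk
  have h1 : Real.log (2 * k / ε) ≤ m * c₁ / ζ * (δ ^ 2 / 3) := by
    have := mul_le_mul_of_nonneg_left hm (by positivity : 0 ≤ c₁ * δ ^ 2 / (3 * ζ))
    have e : c₁ * δ ^ 2 / (3 * ζ) * (3 * ζ / (c₁ * δ ^ 2) * Real.log (2 * k / ε)) = Real.log (2 * k / ε) := by
      field_simp
    rw [e] at this
    refine this.trans (le_of_eq ?_)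
    field_simp
  have h2 : m * c₁ / ζ * (δ ^ 2 / 3) ≤ m * c / ζ * q := by
    have hc0 : 0 < c := by linarith
    gcongr
  have h3 : Real.exp E ≤ ε / (2 * k) := by
    rw [← Real.exp_log (by positivity : 0 < ε / (2 * k)), Real.exp_le_exp, hE, ← inv_div (2 * (k : ℝ)), Real.log_inv]
    linarith
  calc k * Real.exp E ≤ k * (ε / (2 * k)) := by gcongr
    _ = _ := by field_simp

/-- Theorem II.1: if `ω₁,…,ω_m` are drawn i.i.d. from `{1,…,n}` with PMF `p`, then for
`m ≥ (3ζ/(c₁δ²))·log(2k/ε)` the two-sided frame inequality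
`(1−δ)c₁‖x‖₂² ≤ (1/m)‖P_Ω^{−1/2}Ψx‖₂² ≤ (1+δ)c₂‖x‖₂²` holds simultaneously for all
`k`-bandlimited signals `x ∈ span(U_k)` with probability at least `1−ε`. -/
theorem random_sampling_frame_bound (n k m : ℕ) (hk : k ≤ n)
    (L U : Matrix (Fin n) (Fin n) ℝ) (lam : Fin n → ℝ) (hmono : Monotone lam)
    (hU : Uᵀ * U = 1) (hU' : U * Uᵀ = 1)
    (hL : L = U * Matrix.diagonal lam * Uᵀ)
    (g : Polynomial ℝ) (hg : ∀ j : Fin n, g.eval (lam j) ≠ 0)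
    (Φ : Matrix (Fin n) (Fin n) ℝ) (hΦ : Φ = Polynomial.aeval L g)
    (Uk : Matrix (Fin n) (Fin k) ℝ) (hUk : Uk = U.submatrix id (Fin.castLE hk))
    (p : Fin n → ℝ) (hp : ∀ i, 0 < p i) (hp1 : ∑ i, p i = 1)
    (c₁ c₂ ζ : ℝ)
    (hc₁ : c₁ = ⨅ j : Fin k, (g.eval (lam (Fin.castLE hk j))) ^ 2)
    (hc₂ : c₂ = ⨆ j : Fin k, (g.eval (lam (Fin.castLE hk j))) ^ 2)
    (hζ : ζ = ⨆ i : Fin n, (∑ j : Fin k, ((Ukᵀ *ᵥ Φ i) j) ^ 2) / p i)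
    (ν : Measure (Fin n)) [IsProbabilityMeasure ν]
    (hν : ∀ i : Fin n, ν {i} = ENNReal.ofReal (p i))
    (ε δ : ℝ) (hε : ε ∈ Set.Ioo (0 : ℝ) 1) (hδ : δ ∈ Set.Ioo (0 : ℝ) 1)
    (hm : 3 * ζ / (c₁ * δ ^ 2) * Real.log (2 * k / ε) ≤ (m : ℝ)) :
    ENNReal.ofReal (1 - ε) ≤
      (Measure.pi fun _ : Fin m => ν)
        {ω : Fin m → Fin n |
          ∀ x ∈ Submodule.span ℝ (Set.range fun j : Fin k => fun i : Fin n => Uk i j),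
            (1 - δ) * c₁ * (∑ t, (x t) ^ 2) ≤
                (1 / (m : ℝ)) * ∑ i : Fin m, (∑ t, Φ (ω i) t * x t) ^ 2 / p (ω i) ∧
              (1 / (m : ℝ)) * ∑ i : Fin m, (∑ t, Φ (ω i) t * x t) ^ 2 / p (ω i) ≤
                (1 + δ) * c₂ * (∑ t, (x t) ^ 2)} := by
  rcases Nat.eq_zero_or_pos k with hk0 | hkpos
  · subst hk0
    have : {ω : Fin m → Fin n |
          ∀ x ∈ Submodule.span ℝ (Set.range fun j : Fin 0 => fun i : Fin n => Uk i j),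
            (1 - δ) * c₁ * (∑ t, (x t) ^ 2) ≤
                (1 / (m : ℝ)) * ∑ i : Fin m, (∑ t, Φ (ω i) t * x t) ^ 2 / p (ω i) ∧
              (1 / (m : ℝ)) * ∑ i : Fin m, (∑ t, Φ (ω i) t * x t) ^ 2 / p (ω i) ≤
                (1 + δ) * c₂ * (∑ t, (x t) ^ 2)} = Set.univ := by
      rw [Set.eq_univ_iff_forall]
      intro ω x hx
      have : x = 0 := by simpa [Set.range_eq_empty] using hx
      subst this
      simp
    rw [this, measure_univ]
    exact ENNReal.ofReal_le_one.2 (by linarith [hε.1])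
  have : Nonempty (Fin k) := ⟨⟨0, hkpos⟩⟩
  set γ : Fin k → ℝ := fun j => g.eval (lam (Fin.castLE hk j)) with hγ
  have hγ0 : ∀ j, 0 < γ j ^ 2 := fun j => by have := hg (Fin.castLE hk j); positivity
  have hc1le : ∀ j, c₁ ≤ γ j ^ 2 := fun j => hc₁ ▸ ciInf_le (Set.finite_range _).bddBelow j
  have hc2le : ∀ j, γ j ^ 2 ≤ c₂ := fun j => hc₂ ▸ le_ciSup (f := fun j => γ j ^ 2) (Set.finite_range _).bddAbove j
  have hc1pos : 0 < c₁ := by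
    obtain ⟨j, hj⟩ := exists_eq_ciInf_of_finite (f := fun j => γ j ^ 2)
    rw [hc₁, ← hj]; exact hγ0 j
  have hc12 : c₁ ≤ c₂ := (hc1le ⟨0, hkpos⟩).trans (hc2le _)
  have ha : ∀ i j, (Ukᵀ *ᵥ Φ i) j = U i (Fin.castLE hk j) * γ j := by
    intro i j
    have h := congrFun (congrFun (phi_mul_U L U lam hU hL g) i) (Fin.castLE hk j)
    rw [mul_diagonal, ← hΦ] at h
    rw [hγ]; dsimp only
    rw [← h, hUk]
    simp [mulVec, dotProduct, mul_apply, mul_comm]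
  have horth : ∀ j l : Fin k, ∑ i, U i (Fin.castLE hk j) * U i (Fin.castLE hk l) = if j = l then 1 else 0 := by
    intro j l
    have h := congrFun (congrFun hU (Fin.castLE hk j)) (Fin.castLE hk l)
    simpa [mul_apply, one_apply] using h
  set v : Fin n → Fin k → ℝ := fun i => (√(p i))⁻¹ • (Ukᵀ *ᵥ Φ i) with hv
  have hsq : ∀ i, (√(p i))⁻¹ * (√(p i))⁻¹ = (p i)⁻¹ := fun i => by
    rw [← mul_inv, Real.mul_self_sqrt (hp i).le]
  have hvv : ∀ i, v i ⬝ᵥ v i = (∑ j : Fin k, ((Ukᵀ *ᵥ Φ i) j) ^ 2) / p i := by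
    intro i
    rw [hv]; dsimp only
    rw [smul_dotProduct, dotProduct_smul, smul_smul, hsq, smul_eq_mul, div_eq_inv_mul]
    simp only [dotProduct, pow_two]
  have hvζ : ∀ i, v i ⬝ᵥ v i ≤ ζ := by
    intro i
    rw [hvv, hζ]
    exact le_ciSup (f := fun i => (∑ j : Fin k, ((Ukᵀ *ᵥ Φ i) j) ^ 2) / p i) (Set.finite_range _).bddAbove i
  have hG : ∑ i, p i • vecMulVec (v i) (v i) = diagonal (fun j => γ j ^ 2) := by
    ext j l
    rw [Matrix.sum_apply]
    have : ∀ i, (p i • vecMulVec (v i) (v i)) j l =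
        γ j * γ l * (U i (Fin.castLE hk j) * U i (Fin.castLE hk l)) := by
      intro i
      simp only [Matrix.smul_apply, vecMulVec_apply, hv, Pi.smul_apply, smul_eq_mul, ha]
      have h1 : p i * ((√(p i))⁻¹ * (√(p i))⁻¹) = 1 := by rw [hsq, mul_inv_cancel₀ (hp i).ne']
      linear_combination (γ j * γ l * (U i (Fin.castLE hk j) * U i (Fin.castLE hk l))) * h1
    simp only [this]
    rw [← Finset.mul_sum, horth, diagonal_apply]
    split_ifs with h
    · subst h; ring
    · simp
  have hζpos : 0 < ζ := by
    have h1 : ∑ i, p i * (v i ⬝ᵥ v i) ≤ ζ := by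
      calc _ ≤ ∑ i, p i * ζ := Finset.sum_le_sum fun i _ => mul_le_mul_of_nonneg_left (hvζ i) (hp i).le
        _ = ζ := by rw [← Finset.sum_mul, hp1, one_mul]
    have h2 : ∑ i, p i * (v i ⬝ᵥ v i) = ∑ j, γ j ^ 2 := by
      have := congrArg trace hG
      rw [trace_sum, trace_diagonal] at this
      simpa [trace_smul, trace_vecMulVec] using this
    have h3 : 0 < ∑ j, γ j ^ 2 := Finset.sum_pos (fun j _ => hγ0 j) Finset.univ_nonempty
    linarith
  obtain ⟨hε0, hε1⟩ := hε
  obtain ⟨hδ0, hδ1⟩ := hδ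
  have hmpos : (0 : ℝ) < m := by
    refine lt_of_lt_of_le ?_ hm
    have hk1 : (1 : ℝ) ≤ k := by exact_mod_cast hkpos
    have : 0 < Real.log (2 * k / ε) := Real.log_pos (by rw [lt_div_iff₀ hε0]; linarith)
    positivity
  -- the two bad events
  classical
  set sU : Finset (Fin m → Fin n) := Finset.univ.filter fun ω =>
    ∃ y : Fin k → ℝ, m * (1 + δ) * c₂ * (y ⬝ᵥ y) < ∑ i, (v (ω i) ⬝ᵥ y) ^ 2 with hsU
  set sL : Finset (Fin m → Fin n) := Finset.univ.filter fun ω =>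
    ∃ y : Fin k → ℝ, ∑ i, (v (ω i) ⬝ᵥ y) ^ 2 < m * (1 - δ) * c₁ * (y ⬝ᵥ y) with hsL
  have hupper : ∑ ω ∈ sU, ∏ i, p (ω i) ≤ ε / 2 := by
    set θ := Real.log (1 + δ) / ζ with hθ
    have hθpos : 0 < θ := div_pos (Real.log_pos (by linarith)) hζpos
    have hθζ : Real.exp (θ * ζ) - 1 = δ := by
      rw [hθ, div_mul_cancel₀ _ hζpos.ne', Real.exp_log (by linarith)]; ring
    have h := tail_aux (m := m) p hp hp1 v ζ c₂ θ (θ * (m * (1 + δ) * c₂)) hζpos hvζ ?_ sU ?_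
    · refine h.trans (exponent_bound k m hkpos ζ c₂ c₁ δ ε hζpos hc1pos hc12 hδ0 hε0 hm _ _
        (scalar_up δ hδ0 hδ1) ?_)
      rw [hθζ, hθ]
      field_simp
      ring
    · rw [hθζ, hG]
      refine PosSemidef.smul ?_ (by positivity)
      rw [← diagonal_one, ← diagonal_smul, diagonal_sub, posSemidef_diagonal_iff]
      intro j
      simpa using hc2le j
    · intro ω hω
      obtain ⟨y, hy⟩ := (Finset.mem_filter.1 hω).2
      exact ⟨y, by rw [mul_assoc]; exact mul_lt_mul_of_pos_left hy hθpos⟩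
  have hlower : ∑ ω ∈ sL, ∏ i, p (ω i) ≤ ε / 2 := by
    set θ := Real.log (1 - δ) / ζ with hθ
    have hθneg : θ < 0 := div_neg_of_neg_of_pos (Real.log_neg (by linarith) (by linarith)) hζpos
    have hθζ : Real.exp (θ * ζ) - 1 = -δ := by
      rw [hθ, div_mul_cancel₀ _ hζpos.ne', Real.exp_log (by linarith)]; ring
    have h := tail_aux (m := m) p hp hp1 v ζ c₁ θ (θ * (m * (1 - δ) * c₁)) hζpos hvζ ?_ sL ?_
    · refine h.trans (exponent_bound k m hkpos ζ c₁ c₁ δ ε hζpos hc1pos le_rfl hδ0 hε0 hm _ _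
        (scalar_low δ hδ0 hδ1) ?_)
      rw [hθζ, hθ]
      field_simp
      ring
    · rw [hθζ, hG, neg_div, neg_smul, ← smul_neg, neg_sub]
      refine PosSemidef.smul ?_ (by positivity)
      rw [← diagonal_one, ← diagonal_smul, diagonal_sub, posSemidef_diagonal_iff]
      intro j
      simpa using hc1le j
    · intro ω hω
      obtain ⟨y, hy⟩ := (Finset.mem_filter.1 hω).2
      exact ⟨y, by rw [mul_assoc]; exact mul_lt_mul_of_neg_left hy hθneg⟩
  set good := {ω : Fin m → Fin n |
          ∀ x ∈ Submodule.span ℝ (Set.range fun j : Fin k => fun i : Fin n => Uk i j),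
            (1 - δ) * c₁ * (∑ t, (x t) ^ 2) ≤
                (1 / (m : ℝ)) * ∑ i : Fin m, (∑ t, Φ (ω i) t * x t) ^ 2 / p (ω i) ∧
              (1 / (m : ℝ)) * ∑ i : Fin m, (∑ t, Φ (ω i) t * x t) ^ 2 / p (ω i) ≤
                (1 + δ) * c₂ * (∑ t, (x t) ^ 2)} with hgood
  have hsub : goodᶜ ⊆ (sU : Set (Fin m → Fin n)) ∪ (sL : Set (Fin m → Fin n)) := by
    intro ω hω
    by_contra hcon
    apply hω
    simp only [Set.mem_union, not_or, hsU, hsL, Finset.coe_filter, Finset.mem_univ, true_and, 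
      Set.mem_ofPred_eq, not_exists, not_lt] at hcon
    obtain ⟨hu, hl⟩ := hcon
    rw [hgood, Set.mem_ofPred_eq]
    intro x hx
    obtain ⟨y, hy⟩ := (Submodule.mem_span_range_iff_exists_fun ℝ).1 hx
    have hxy : x = Uk *ᵥ y := by
      rw [← hy]; ext t
      simp [mulVec, dotProduct, mul_comm]
    have hUkUk : Ukᵀ * Uk = 1 := by
      ext j l
      rw [mul_apply, one_apply, ← horth j l, hUk]
      simp
    have hnorm : ∑ t, (x t) ^ 2 = y ⬝ᵥ y := by
      have : ∑ t, (x t) ^ 2 = x ⬝ᵥ x := by simp only [dotProduct, pow_two]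
      rw [this, hxy, dotProduct_mulVec, ← mulVec_transpose, mulVec_mulVec, hUkUk, one_mulVec]
    have hmeas : ∀ i, (∑ t, Φ i t * x t) ^ 2 / p i = (v i ⬝ᵥ y) ^ 2 := by
      intro i
      have h1 : ∑ t, Φ i t * x t = (Ukᵀ *ᵥ Φ i) ⬝ᵥ y := by
        rw [mulVec_transpose, ← dotProduct_mulVec, ← hxy]; rfl
      rw [h1, hv]; dsimp only
      rw [smul_dotProduct, smul_eq_mul, mul_pow, pow_two (√(p i))⁻¹, hsq, div_eq_inv_mul]
    simp only [hmeas, hnorm]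
    have hu' := hu y
    have hl' := hl y
    constructor
    · rw [one_div, ← div_eq_inv_mul, le_div_iff₀ hmpos]; linarith
    · rw [one_div, ← div_eq_inv_mul, div_le_iff₀ hmpos]; linarith
  have hbad : (Measure.pi fun _ : Fin m => ν) goodᶜ ≤ ENNReal.ofReal ε := by
    refine (measure_mono hsub).trans ((measure_union_le _ _).trans ?_)
    rw [measure_pi_real_finset p hp ν hν, measure_pi_real_finset p hp ν hν]
    have : ENNReal.ofReal ε = ENNReal.ofReal (ε / 2) + ENNReal.ofReal (ε / 2) := by
      rw [← ENNReal.ofReal_add (by linarith) (by linarith)]; congr 1; ring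
    rw [this]
    exact add_le_add (ENNReal.ofReal_le_ofReal hupper) (ENNReal.ofReal_le_ofReal hlower)
  have hmg : MeasurableSet good := (Set.toFinite good).measurableSet
  rw [ENNReal.ofReal_sub _ hε0.le, ENNReal.ofReal_one, tsub_le_iff_right]
  calc (1 : ENNReal) = (Measure.pi fun _ : Fin m => ν) good + (Measure.pi fun _ : Fin m => ν) goodᶜ := by
        rw [measure_add_measure_compl hmg, measure_univ]
    _ ≤ _ := by gcongr
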